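/- Fix b ∈ (0,3) and let u be a global classical H² solution with nonnegative momentum of the b-family equation. Set λ(t) = t^{1/2}/log t. Then liminf_{t→∞} ∫_ℝ sech²(x/λ(t)) ( u(t,x)² + (∂_x u)(t,x)² ) dx = 0. -/

import Mathlib

open MeasureTheory Real Filter

/-- Convolution with the Green's function of `1 - d²/dx²` on `ℝ`. -/
noncomputable def G (f : ℝ → ℝ) (x : ℝ) : ℝ :=
  (1 / 2) * ∫ y : ℝ, Real.exp (-|x - y|) * f y

/-- The flux of the nonlocal `b`-family equation at time `t`:
`(1/2)u² + G((b/2)u² + ((3-b)/2)(∂ₓu)²)`. -/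
noncomputable def flux (b : ℝ) (u : ℝ → ℝ → ℝ) (t : ℝ) : ℝ → ℝ :=
  fun y => (1 / 2) * (u t y) ^ 2
    + G (fun z => (b / 2) * (u t z) ^ 2 + ((3 - b) / 2) * (deriv (u t) z) ^ 2) y

/-- The momentum `m = u - ∂ₓ²u`. -/
noncomputable def mom (u : ℝ → ℝ → ℝ) (t x : ℝ) : ℝ :=
  u t x - deriv (deriv (u t)) x

/-- `λ_c(t) = t^c / log t`. -/
noncomputable def lam (c t : ℝ) : ℝ := t ^ c / Real.log t

/-- `sech² z`. -/
noncomputable def sech2 (z : ℝ) : ℝ := (1 / Real.cosh z) ^ 2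

/-- A global classical `H²` solution with nonnegative momentum of the nonlocal `b`-family
equation: `C¹` in `t`, `C³` in `x`, jointly continuous partial derivatives, solving the
equation pointwise on `(0,∞) × ℝ`, with `u(t,·), ∂ₓu(t,·), ∂ₓ²u(t,·) ∈ L¹(ℝ) ∩ L²(ℝ)`,
nonnegative momentum `m(t,·) ≥ 0`, and conserved total momentum
`∫ m(t,x) dx = ∫ m(0,x) dx`. -/
def IsH2NonnegMomentumSolution (b : ℝ) (u : ℝ → ℝ → ℝ) : Prop :=
  (∀ x : ℝ, ContDiff ℝ 1 fun t => u t x) ∧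
  (∀ t : ℝ, ContDiff ℝ 3 (u t)) ∧
  Continuous (fun p : ℝ × ℝ => u p.1 p.2) ∧
  Continuous (fun p : ℝ × ℝ => deriv (fun s => u s p.2) p.1) ∧
  Continuous (fun p : ℝ × ℝ => deriv (u p.1) p.2) ∧
  Continuous (fun p : ℝ × ℝ => deriv (deriv (u p.1)) p.2) ∧
  Continuous (fun p : ℝ × ℝ => deriv (fun s => deriv (u s) p.2) p.1) ∧
  Continuous (fun p : ℝ × ℝ => deriv (fun s => deriv (deriv (u s)) p.2) p.1) ∧
  (∀ t x : ℝ, 0 < t → deriv (fun s => u s x) t + deriv (flux b u t) x = 0) ∧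
  (∀ t : ℝ, 0 ≤ t →
    Integrable (u t) ∧ Integrable (fun x => (u t x) ^ 2)
    ∧ Integrable (deriv (u t)) ∧ Integrable (fun x => (deriv (u t) x) ^ 2)
    ∧ Integrable (deriv (deriv (u t))) ∧ Integrable (fun x => (deriv (deriv (u t)) x) ^ 2)) ∧
  (∀ t x : ℝ, 0 ≤ t → 0 ≤ mom u t x) ∧
  (∀ t : ℝ, 0 ≤ t → ∫ x : ℝ, mom u t x = ∫ x : ℝ, mom u 0 x)

section Aux
open Topology Set

lemma profile_facts (v : ℝ → ℝ) (hc : ContDiff ℝ 3 v) (h0 : Integrable v)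
    (h1 : Integrable (deriv v)) (h2 : Integrable (deriv (deriv v)))
    (hm : ∀ x, 0 ≤ v x - deriv (deriv v) x) :
    (∀ x, 0 ≤ v x) ∧ (∀ x, |deriv v x| ≤ v x) ∧ (∀ x, v x ≤ ∫ y, v y) ∧
    (∫ x, (v x - deriv (deriv v) x) = ∫ x, v x) ∧
    Tendsto v atTop (𝓝 0) ∧ Tendsto v atBot (𝓝 0) := by
  have hd : ∀ x, HasDerivAt v (deriv v x) x := fun x =>
    (hc.differentiable (by norm_num) x).hasDerivAt
  have hc1 : ContDiff ℝ 2 (deriv v) := by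
    have : ContDiff ℝ (2 + 1) v := by norm_num; exact hc
    exact (contDiff_succ_iff_deriv.1 this).2.2
  have hd2 : ∀ x, HasDerivAt (deriv v) (deriv (deriv v) x) x := fun x =>
    (hc1.differentiable (by norm_num) x).hasDerivAt
  have t1 : Tendsto v atTop (𝓝 0) :=
    tendsto_zero_of_hasDerivAt_of_integrableOn_Ioi (a := 0) (fun x _ => hd x)
      h1.integrableOn h0.integrableOn
  have t2 : Tendsto v atBot (𝓝 0) :=
    tendsto_zero_of_hasDerivAt_of_integrableOn_Iic (a := 0) (fun x _ => hd x)
      h1.integrableOn h0.integrableOn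
  have t3 : Tendsto (deriv v) atTop (𝓝 0) :=
    tendsto_zero_of_hasDerivAt_of_integrableOn_Ioi (a := 0) (fun x _ => hd2 x)
      h2.integrableOn h1.integrableOn
  have t4 : Tendsto (deriv v) atBot (𝓝 0) :=
    tendsto_zero_of_hasDerivAt_of_integrableOn_Iic (a := 0) (fun x _ => hd2 x)
      h2.integrableOn h1.integrableOn
  have A : ∀ x, 0 ≤ v x - deriv v x := by
    have dA : ∀ x, HasDerivAt (fun x => exp x * (v x - deriv v x))
        (exp x * (v x - deriv (deriv v) x)) x := by
      intro x
      have := (Real.hasDerivAt_exp x).mul ((hd x).sub (hd2 x))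
      convert! this using 1
      simp only [Pi.sub_apply]; ring
    have mono : Monotone (fun x => exp x * (v x - deriv v x)) :=
      monotone_of_deriv_nonneg (fun x => (dA x).differentiableAt)
        (fun x => by rw [(dA x).deriv]; exact mul_nonneg (exp_pos x).le (hm x))
    have lim : Tendsto (fun x => exp x * (v x - deriv v x)) atBot (𝓝 0) := by
      simpa using Real.tendsto_exp_atBot.mul (t2.sub t4)
    intro x
    have := mono.le_of_tendsto lim x
    exact nonneg_of_mul_nonneg_right this (exp_pos x)
  have B : ∀ x, 0 ≤ v x + deriv v x := by
    have dA : ∀ x, HasDerivAt (fun x => exp (-x) * (v x + deriv v x))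
        (-(exp (-x) * (v x - deriv (deriv v) x))) x := by
      intro x
      have := ((hasDerivAt_neg x).exp).mul ((hd x).add (hd2 x))
      convert! this using 1
      simp only [Pi.add_apply]; ring
    have mono : Antitone (fun x => exp (-x) * (v x + deriv v x)) :=
      antitone_of_deriv_nonpos (fun x => (dA x).differentiableAt)
        (fun x => by
          rw [(dA x).deriv]; exact neg_nonpos.2 (mul_nonneg (exp_pos _).le (hm x)))
    have lim : Tendsto (fun x => exp (-x) * (v x + deriv v x)) atTop (𝓝 0) := by
      simpa using (Real.tendsto_exp_neg_atTop_nhds_zero).mul (t1.add t3)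
    intro x
    have := mono.le_of_tendsto lim x
    exact nonneg_of_mul_nonneg_right this (exp_pos _)
  have N : ∀ x, 0 ≤ v x := fun x => by linarith [A x, B x]
  have L : ∀ x, |deriv v x| ≤ v x := fun x => abs_le.2 ⟨by linarith [B x], by linarith [A x]⟩
  refine ⟨N, L, ?_, ?_, t1, t2⟩
  · intro x
    have e := integral_Iic_of_hasDerivAt_of_tendsto' (a := x) (fun y _ => hd y)
      h1.integrableOn t2
    calc v x = ∫ y in Iic x, deriv v y := by rw [e]; ring
      _ ≤ ∫ y in Iic x, v y := setIntegral_mono h1.integrableOn h0.integrableOn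
          (fun y => (le_abs_self _).trans (L y))
      _ ≤ ∫ y, v y := setIntegral_le_integral h0 (Eventually.of_forall N)
  · rw [integral_sub h0 h2, integral_eq_zero_of_hasDerivAt_of_integrable hd2 h2 h1, sub_zero]

lemma exp_kernel_le (x y : ℝ) : exp (-|x - y|) ≤ 1 := by
  rw [exp_le_one_iff]; simp

lemma kernel_integrable (f : ℝ → ℝ) (hf : Integrable f) (x : ℝ) :
    Integrable (fun y => exp (-|x - y|) * f y) := by
  refine hf.bdd_mul (c := 1) ?_ ?_
  · exact (by fun_prop : Continuous fun y => exp (-|x - y|)).aestronglyMeasurable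
  · refine Eventually.of_forall fun y => ?_
    rw [Real.norm_eq_abs, abs_of_pos (exp_pos _)]; exact exp_kernel_le x y

lemma G_nonneg (f : ℝ → ℝ) (hp : ∀ x, 0 ≤ f x) (x : ℝ) : 0 ≤ G f x := by
  unfold G
  have : 0 ≤ ∫ y : ℝ, Real.exp (-|x - y|) * f y :=
    integral_nonneg fun y => mul_nonneg (exp_pos _).le (hp y)
  linarith

lemma G_le (f : ℝ → ℝ) (hf : Integrable f) (hp : ∀ x, 0 ≤ f x) (x : ℝ) :
    G f x ≤ (1 / 2) * ∫ y, f y := by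
  unfold G
  have : ∫ y : ℝ, Real.exp (-|x - y|) * f y ≤ ∫ y, f y :=
    integral_mono (kernel_integrable f hf x) hf
      fun y => mul_le_of_le_one_left (hp y) (exp_kernel_le x y)
  linarith

lemma G_tendsto (f : ℝ → ℝ) (hf : Integrable f) (l : Filter ℝ) [l.IsCountablyGenerated]
    (hl : Tendsto (fun x : ℝ => |x|) l atTop) : Tendsto (G f) l (𝓝 0) := by
  have : Tendsto (fun x => ∫ y : ℝ, Real.exp (-|x - y|) * f y) l (𝓝 (∫ y : ℝ, (0:ℝ))) := by
    refine tendsto_integral_filter_of_dominated_convergence (fun y => ‖f y‖) ?_ ?_ hf.norm ?_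
    · exact Eventually.of_forall fun x => (kernel_integrable f hf x).aestronglyMeasurable
    · refine Eventually.of_forall fun x => Eventually.of_forall fun y => ?_
      rw [norm_mul, Real.norm_eq_abs, abs_of_pos (exp_pos _)]
      exact mul_le_of_le_one_left (norm_nonneg _) (exp_kernel_le x y)
    · refine Eventually.of_forall fun y => ?_
      have h1 : Tendsto (fun x : ℝ => |x - y|) l atTop := by
        refine tendsto_atTop_mono (fun x => ?_) (tendsto_atTop_add_const_right l (-|y|) hl)
        linarith [abs_sub_abs_le_abs_sub x y]
      simpa using (Real.tendsto_exp_neg_atTop_nhds_zero.comp h1).mul_const (f y)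
  have h2 := this.const_mul (1/2)
  have e : G f = fun x => (1 / 2) * ∫ y : ℝ, Real.exp (-|x - y|) * f y := rfl
  rw [e]
  simpa using h2

lemma G_differentiable (f : ℝ → ℝ) (hf : Integrable f) (hc : Continuous f) :
    Differentiable ℝ (G f) := by
  have i1 : ∀ x, IntegrableOn (fun y => exp y * f y) (Iic x) := by
    intro x
    refine hf.integrableOn.bdd_mul (c := exp x) ?_ ?_
    · exact (by fun_prop : Continuous fun y => exp y).aestronglyMeasurable
    · filter_upwards [ae_restrict_mem measurableSet_Iic] with y hy
      rw [Real.norm_eq_abs, abs_of_pos (exp_pos _)]; exact exp_le_exp.2 hy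
  have i2 : ∀ x, IntegrableOn (fun y => exp (-y) * f y) (Ioi x) := by
    intro x
    refine hf.integrableOn.bdd_mul (c := exp (-x)) ?_ ?_
    · exact (by fun_prop : Continuous fun y => exp (-y)).aestronglyMeasurable
    · filter_upwards [ae_restrict_mem measurableSet_Ioi] with y hy
      rw [Real.norm_eq_abs, abs_of_pos (exp_pos _)]
      exact exp_le_exp.2 (neg_le_neg (le_of_lt hy))
  have c1 : Continuous (fun y => exp y * f y) := by fun_prop
  have c2 : Continuous (fun y => exp (-y) * f y) := by fun_prop
  have key : G f = fun x => (1 / 2) * (exp (-x) * ((∫ y in Iic 0, exp y * f y) +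
      ∫ y in (0:ℝ)..x, exp y * f y) + exp x * ((∫ y in Ioi 0, exp (-y) * f y) -
      ∫ y in (0:ℝ)..x, exp (-y) * f y)) := by
    funext x
    unfold G
    have e1 := intervalIntegral.integral_Iic_sub_Iic (i1 0) (i1 x)
    have e2 := intervalIntegral.integral_Ioi_sub_Ioi' (i2 0) (i2 x)
    rw [← e1, ← e2]
    congr 1
    rw [← intervalIntegral.integral_Iic_add_Ioi (b := x)
      (kernel_integrable f hf x).integrableOn (kernel_integrable f hf x).integrableOn]
    have a1 : ∫ y in Iic x, exp (-|x - y|) * f y = exp (-x) * ∫ y in Iic x, exp y * f y := by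
      rw [← integral_const_mul]
      refine setIntegral_congr_fun measurableSet_Iic fun y hy => ?_
      have : |x - y| = x - y := abs_of_nonneg (by simpa using hy)
      simp only [this, ← mul_assoc, ← exp_add]; ring_nf
    have a2 : ∫ y in Ioi x, exp (-|x - y|) * f y = exp x * ∫ y in Ioi x, exp (-y) * f y := by
      rw [← integral_const_mul]
      refine setIntegral_congr_fun measurableSet_Ioi fun y hy => ?_
      have : |x - y| = -(x - y) := abs_of_neg (by simpa using hy)
      simp only [this, ← mul_assoc, ← exp_add]; ring_nf
    rw [a1, a2]; ring
  rw [key]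
  have d1 : Differentiable ℝ (fun x => ∫ y in (0:ℝ)..x, exp y * f y) := fun x =>
    (intervalIntegral.integral_hasDerivAt_right (c1.intervalIntegrable _ _)
      (c1.stronglyMeasurableAtFilter _ _) c1.continuousAt).differentiableAt
  have d2 : Differentiable ℝ (fun x => ∫ y in (0:ℝ)..x, exp (-y) * f y) := fun x =>
    (intervalIntegral.integral_hasDerivAt_right (c2.intervalIntegrable _ _)
      (c2.stronglyMeasurableAtFilter _ _) c2.continuousAt).differentiableAt
  fun_prop

lemma tanh_hasDerivAt (z : ℝ) : HasDerivAt Real.tanh (sech2 z) z := by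
  have h := (Real.hasDerivAt_sinh z).div (Real.hasDerivAt_cosh z) (Real.cosh_pos z).ne'
  have e : Real.tanh = fun z => Real.sinh z / Real.cosh z := by
    funext z; exact Real.tanh_eq_sinh_div_cosh z
  rw [e]
  convert! h using 1
  unfold sech2
  have := Real.cosh_sq z
  rw [div_pow, one_pow]
  congr 1
  nlinarith

lemma sech2_nonneg (z : ℝ) : 0 ≤ sech2 z := sq_nonneg _

lemma sech2_le_one (z : ℝ) : sech2 z ≤ 1 := by
  unfold sech2
  have : 1 / Real.cosh z ≤ 1 := by
    rw [div_le_one (Real.cosh_pos z)]; exact Real.one_le_cosh z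
  exact pow_le_one₀ (by have := Real.cosh_pos z; positivity) this

lemma sech2_continuous : Continuous sech2 := by
  unfold sech2
  exact (continuous_const.div Real.continuous_cosh fun x => (Real.cosh_pos x).ne').pow 2

lemma sech2_mono (x l L : ℝ) (hl : 0 < l) (hL : l ≤ L) : sech2 (x / l) ≤ sech2 (x / L) := by
  unfold sech2
  have : Real.cosh (x / L) ≤ Real.cosh (x / l) := by
    rw [Real.cosh_le_cosh, abs_div, abs_div, abs_of_pos hl, abs_of_pos (hl.trans_le hL)]
    gcongr
  have h1 := Real.cosh_pos (x / L)
  have h2 := Real.cosh_pos (x / l)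
  gcongr

set_option maxHeartbeats 2000000 in
lemma main_ineq (b : ℝ) (hb : b ∈ Set.Ioo (0 : ℝ) 3)
    (u : ℝ → ℝ → ℝ) (hu : IsH2NonnegMomentumSolution b u) (t₁ t₂ L a : ℝ)
    (ht₁ : 0 < t₁) (ht : t₁ ≤ t₂) (hL : 0 < L)
    (ha : ∀ t ∈ Icc t₁ t₂, a ≤ ∫ x : ℝ, sech2 (x / L) * ((u t x) ^ 2 + (deriv (u t) x) ^ 2)) :
    (t₂ - t₁) * (a / (4 * L)) ≤ 2 * ∫ x, mom u 0 x := by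
  obtain ⟨hut, hux, c0, ct, cx, -, -, -, heq, hint, hpos, hmass⟩ := hu
  obtain ⟨hb0, hb3⟩ := hb
  set M : ℝ := ∫ x, mom u 0 x with hM
  have prof : ∀ t, 0 ≤ t → (∀ x, 0 ≤ u t x) ∧ (∀ x, |deriv (u t) x| ≤ u t x) ∧
      (∀ x, u t x ≤ M) ∧ (∫ x, u t x = M) ∧
      Tendsto (u t) atTop (𝓝 0) ∧ Tendsto (u t) atBot (𝓝 0) := by
    intro t h
    obtain ⟨i0, -, i1, -, i2, -⟩ := hint t h
    obtain ⟨p1, p2, p3, p4, p5, p6⟩ := profile_facts (u t) (hux t) i0 i1 i2 (fun x => hpos t x h)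
    have e : ∫ x, u t x = M := by rw [← p4]; exact hmass t h
    exact ⟨p1, p2, fun x => e ▸ p3 x, e, p5, p6⟩
  have hsq : ∀ t, 0 ≤ t → ∀ x, (deriv (u t) x) ^ 2 ≤ (u t x) ^ 2 := by
    intro t h x
    exact sq_le_sq.2 (((prof t h).2.1 x).trans (le_abs_self _))
  have hu2 : ∀ t, 0 ≤ t → ∀ x, (u t x) ^ 2 ≤ M * u t x := by
    intro t h x
    have := (prof t h).2.2.1 x
    have := (prof t h).1 x
    nlinarith
  have hM0 : 0 ≤ M := by
    rw [← (prof 0 le_rfl).2.2.2.1]; exact integral_nonneg (prof 0 le_rfl).1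
  have hi2 : ∀ t, 0 ≤ t → ∫ x, (u t x) ^ 2 ≤ M ^ 2 := by
    intro t h
    calc ∫ x, (u t x) ^ 2 ≤ ∫ x, M * u t x :=
          integral_mono (hint t h).2.1 ((hint t h).1.const_mul M) (hu2 t h)
      _ = M ^ 2 := by rw [integral_const_mul, (prof t h).2.2.2.1]; ring
  -- the density inside G
  set f : ℝ → ℝ → ℝ := fun t z => (b / 2) * (u t z) ^ 2 + ((3 - b) / 2) * (deriv (u t) z) ^ 2
    with hf
  have cut : ∀ t, Continuous (u t) := fun t => (hux t).continuous
  have cuxt : ∀ t, Continuous (deriv (u t)) := fun t => (hux t).continuous_deriv (by norm_num)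
  have f0 : ∀ t x, 0 ≤ f t x := by
    intro t x
    have : 0 < 3 - b := by linarith
    simp only [hf]; positivity
  have fi : ∀ t, 0 ≤ t → Integrable (f t) := fun t h =>
    ((hint t h).2.1.const_mul _).add ((hint t h).2.2.2.1.const_mul _)
  have fc : ∀ t, Continuous (f t) := by
    intro t
    have := cut t
    have := cuxt t
    simp only [hf]; fun_prop
  have fle : ∀ t, 0 ≤ t → ∫ x, f t x ≤ 3 / 2 * M ^ 2 := by
    intro t h
    calc ∫ x, f t x ≤ ∫ x, 3 / 2 * (u t x) ^ 2 := by
          refine integral_mono (fi t h) ((hint t h).2.1.const_mul _) fun x => ?_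
          have := hsq t h x
          simp only [hf]; nlinarith
      _ ≤ 3 / 2 * M ^ 2 := by
          rw [integral_const_mul]; have := hi2 t h; linarith
  have hF : ∀ t x, flux b u t x = (1 / 2) * (u t x) ^ 2 + G (f t) x := fun t x => rfl
  have Flow : ∀ t x, (1 / 2) * (u t x) ^ 2 ≤ flux b u t x := by
    intro t x; rw [hF]; linarith [G_nonneg (f t) (f0 t) x]
  have F0 : ∀ t x, 0 ≤ flux b u t x := fun t x => le_trans (by positivity) (Flow t x)
  have Fup : ∀ t, 0 ≤ t → ∀ x, flux b u t x ≤ 2 * M ^ 2 := by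
    intro t h x
    have h1 := G_le (f t) (fi t h) (f0 t) x
    have h2 := fle t h
    have h3 := hu2 t h x
    have h4 := mul_le_mul_of_nonneg_left ((prof t h).2.2.1 x) hM0
    rw [hF]; nlinarith
  have Ftop : ∀ t, 0 ≤ t → Tendsto (flux b u t) atTop (𝓝 0) := by
    intro t h
    have := (((prof t h).2.2.2.2.1.pow 2).const_mul (1 / 2)).add
      (G_tendsto (f t) (fi t h) atTop tendsto_abs_atTop_atTop)
    have e : flux b u t = fun x => (1 / 2) * (u t x) ^ 2 + G (f t) x := rfl
    rw [e]
    simpa using this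
  have Fbot : ∀ t, 0 ≤ t → Tendsto (flux b u t) atBot (𝓝 0) := by
    intro t h
    have := (((prof t h).2.2.2.2.2.pow 2).const_mul (1 / 2)).add
      (G_tendsto (f t) (fi t h) atBot tendsto_abs_atBot_atTop)
    have e : flux b u t = fun x => (1 / 2) * (u t x) ^ 2 + G (f t) x := rfl
    rw [e]
    simpa using this
  have Fd : ∀ t, 0 < t → ∀ x, HasDerivAt (flux b u t) (-deriv (fun s => u s x) t) x := by
    intro t h x
    have d : Differentiable ℝ (flux b u t) := by
      have h1 := G_differentiable (f t) (fi t h.le) (fc t)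
      have h2 : Differentiable ℝ (u t) := (hux t).differentiable (by norm_num)
      have : flux b u t = fun x => (1 / 2) * (u t x) ^ 2 + G (f t) x := rfl
      rw [this]; fun_prop
    have e : -deriv (fun s => u s x) t = deriv (flux b u t) x := by linarith [heq t x h]
    rw [e]; exact (d x).hasDerivAt
  have Fmeas : ∀ x, StronglyMeasurable (fun t => flux b u t x) := by
    intro x
    have h1 : Continuous (fun t => u t x) := c0.comp (by fun_prop : Continuous fun t => (t, x))
    have h2 : Continuous (fun p : ℝ × ℝ => exp (-|x - p.2|) * f p.1 p.2) := by
      simp only [hf]; fun_prop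
    have h3 := h2.stronglyMeasurable.integral_prod_right' (ν := volume)
    have h4 : (fun t => flux b u t x) = fun t => (1 / 2) * (u t x) ^ 2 +
        (1 / 2) * ∫ y, exp (-|x - y|) * f t y := rfl
    rw [h4]
    exact ((by fun_prop : Continuous fun t => (1 / 2) * (u t x) ^ 2).stronglyMeasurable).add
      (h3.const_mul _)
  -- local energy
  set E : ℝ → ℝ → ℝ := fun t x => sech2 (x / L) * ((u t x) ^ 2 + (deriv (u t) x) ^ 2) with hE
  have E0 : ∀ t x, 0 ≤ E t x := fun t x => mul_nonneg (sech2_nonneg _) (by positivity)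
  have cs : Continuous (fun x => sech2 (x / L)) := sech2_continuous.comp (by fun_prop)
  have Ei : ∀ t, 0 ≤ t → Integrable (E t) := by
    intro t h
    refine ((hint t h).2.1.add (hint t h).2.2.2.1).bdd_mul (c := 1) cs.aestronglyMeasurable ?_
    refine Eventually.of_forall fun x => ?_
    rw [Real.norm_eq_abs, abs_of_nonneg (sech2_nonneg _)]; exact sech2_le_one _
  have Ele : ∀ t, 0 ≤ t → ∫ x, E t x ≤ 2 * M ^ 2 := by
    intro t h
    calc ∫ x, E t x ≤ ∫ x, 2 * (u t x) ^ 2 := by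
          refine integral_mono (Ei t h) ((hint t h).2.1.const_mul _) fun x => ?_
          have h1 := hsq t h x
          have h2 := sech2_le_one (x / L)
          have h3 : 0 ≤ (u t x) ^ 2 + (deriv (u t) x) ^ 2 := by positivity
          have := mul_le_mul_of_nonneg_right h2 h3
          simp only [hE]; linarith
      _ ≤ 2 * M ^ 2 := by
          rw [integral_const_mul]; have := hi2 t h; linarith
  have Ec : Continuous (fun p : ℝ × ℝ => E p.1 p.2) := by
    have : Continuous (fun p : ℝ × ℝ => sech2 (p.2 / L)) := cs.comp continuous_snd
    simp only [hE]; fun_prop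
  have Ect : ∀ t, Continuous (E t) := fun t =>
    Ec.comp (by fun_prop : Continuous fun x : ℝ => (t, x))
  -- the truncated lower bound
  set D : ℝ → ℝ → ℝ := fun R t =>
    1 / (4 * L) * (∫ x in (-R)..R, E t x) - flux b u t R - flux b u t (-R) with hD
  have ctx : ∀ t, Continuous (fun x => deriv (fun s => u s x) t) := fun t =>
    ct.comp (by fun_prop : Continuous fun x : ℝ => (t, x))
  have cφ : Continuous (fun x => Real.tanh (x / L)) := by
    have h : Continuous Real.tanh :=
      continuous_iff_continuousAt.2 fun z => (tanh_hasDerivAt z).continuousAt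
    exact h.comp (by fun_prop)
  have step : ∀ R, 0 ≤ R → ∀ t, 0 < t →
      D R t ≤ ∫ x in (-R)..R, Real.tanh (x / L) * deriv (fun s => u s x) t := by
    intro R hR t h
    have hφ : ∀ x, HasDerivAt (fun x => Real.tanh (x / L)) (sech2 (x / L) * (1 / L)) x := by
      intro x
      exact (tanh_hasDerivAt (x / L)).comp x ((hasDerivAt_id x).div_const L)
    have cF : Continuous (flux b u t) :=
      continuous_iff_continuousAt.2 fun x => (Fd t h x).continuousAt
    have ibp := intervalIntegral.integral_mul_deriv_eq_deriv_mul_of_hasDerivAt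
      (a := -R) (b := R) cφ.continuousOn cF.continuousOn (fun x _ => hφ x)
      (fun x _ => Fd t h x) ((cs.mul_const (1 / L)).intervalIntegrable _ _)
      ((ctx t).neg.intervalIntegrable _ _)
    simp only [mul_neg, intervalIntegral.integral_neg] at ibp
    have low : 1 / (4 * L) * (∫ x in (-R)..R, E t x) ≤
        ∫ x in (-R)..R, sech2 (x / L) * (1 / L) * flux b u t x := by
      rw [← intervalIntegral.integral_const_mul]
      refine intervalIntegral.integral_mono_on (by linarith)
        ((continuous_const.mul (Ect t)).intervalIntegrable _ _)
        (((cs.mul_const (1 / L)).mul cF).intervalIntegrable _ _) fun x _ => ?_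
      have h1 := Flow t x
      have h2 := hsq t h.le x
      have h3 : 1 / 4 * ((u t x) ^ 2 + (deriv (u t) x) ^ 2) ≤ flux b u t x := by linarith
      have h4 : 0 ≤ sech2 (x / L) * (1 / L) := mul_nonneg (sech2_nonneg _) (by positivity)
      have h5 := mul_le_mul_of_nonneg_left h3 h4
      refine le_trans (le_of_eq ?_) h5
      simp only [hE]; field_simp
    have b1 : Real.tanh (R / L) * flux b u t R ≤ flux b u t R :=
      mul_le_of_le_one_left (F0 t R) (Real.tanh_lt_one _).le
    have b2 : -Real.tanh (-R / L) * flux b u t (-R) ≤ flux b u t (-R) :=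
      mul_le_of_le_one_left (F0 t (-R)) (by linarith [Real.neg_one_lt_tanh (-R / L)])
    simp only [hD]
    linarith
  have upper : ∀ R, 0 ≤ R →
      ∫ t in t₁..t₂, (∫ x in (-R)..R, Real.tanh (x / L) * deriv (fun s => u s x) t) ≤ 2 * M := by
    intro R hR
    have cj : Continuous (fun p : ℝ × ℝ => Real.tanh (p.2 / L) * deriv (fun s => u s p.2) p.1) :=
      (cφ.comp continuous_snd).mul ct
    rw [intervalIntegral_intervalIntegral_swap]
    · have e : ∀ x, ∫ t in t₁..t₂, Real.tanh (x / L) * deriv (fun s => u s x) t =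
          Real.tanh (x / L) * u t₂ x - Real.tanh (x / L) * u t₁ x := by
        intro x
        rw [intervalIntegral.integral_const_mul, intervalIntegral.integral_deriv_eq_sub]
        · ring
        · intro t _; exact (hut x).differentiable (by norm_num) t
        · exact (ct.comp (by fun_prop : Continuous fun t : ℝ => (t, x))).intervalIntegrable _ _
      simp only [e]
      have bd : ∀ x, Real.tanh (x / L) * u t₂ x - Real.tanh (x / L) * u t₁ x ≤
          u t₂ x + u t₁ x := by
        intro x
        have h1 := (prof t₂ (ht₁.le.trans ht)).1 x
        have h2 := (prof t₁ ht₁.le).1 x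
        have h3 := (Real.tanh_lt_one (x / L)).le
        have h4 := (Real.neg_one_lt_tanh (x / L)).le
        nlinarith
      have c1 := cut t₁
      have c2 := cut t₂
      calc _ ≤ ∫ x in (-R)..R, (u t₂ x + u t₁ x) := by
            refine intervalIntegral.integral_mono_on (by linarith) ?_ ?_ fun x _ => bd x
            · exact ((cφ.mul c2).sub (cφ.mul c1)).intervalIntegrable _ _
            · exact (c2.add c1).intervalIntegrable _ _
        _ ≤ ∫ x, (u t₂ x + u t₁ x) := by
            rw [intervalIntegral.integral_of_le (by linarith)]
            refine setIntegral_le_integral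
              ((hint t₂ (ht₁.le.trans ht)).1.add (hint t₁ ht₁.le).1) (Eventually.of_forall fun x => ?_)
            exact add_nonneg ((prof t₂ (ht₁.le.trans ht)).1 x) ((prof t₁ ht₁.le).1 x)
        _ = 2 * M := by
            rw [integral_add (hint t₂ (ht₁.le.trans ht)).1 (hint t₁ ht₁.le).1,
              (prof t₂ (ht₁.le.trans ht)).2.2.2.1, (prof t₁ ht₁.le).2.2.2.1]; ring
    · refine (cj.continuousOn.integrableOn_compact
        (isCompact_uIcc.prod isCompact_uIcc)).mono_set
        (Set.prod_mono uIoc_subset_uIcc uIoc_subset_uIcc)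
  have Dmeas : ∀ R, 0 ≤ R → StronglyMeasurable (D R) := by
    intro R hR
    have h3 := Ec.stronglyMeasurable.integral_prod_right' (ν := volume.restrict (Ioc (-R) R))
    simp only [hD]
    refine ((StronglyMeasurable.const_mul ?_ _).sub (Fmeas R)).sub (Fmeas (-R))
    simp only [intervalIntegral.integral_of_le (by linarith : -R ≤ R)]
    exact h3
  have Eint0 : ∀ R, 0 ≤ R → ∀ t, 0 ≤ t → 0 ≤ (∫ x in (-R)..R, E t x) ∧
      (∫ x in (-R)..R, E t x) ≤ 2 * M ^ 2 := by
    intro R hR t h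
    constructor
    · exact intervalIntegral.integral_nonneg (by linarith) fun x _ => E0 t x
    · rw [intervalIntegral.integral_of_le (by linarith)]
      exact (setIntegral_le_integral (Ei t h) (Eventually.of_forall (E0 t))).trans (Ele t h)
  set C : ℝ := 1 / (4 * L) * (2 * M ^ 2) + 4 * M ^ 2 with hC
  have Dbd : ∀ R, 0 ≤ R → ∀ t, 0 ≤ t → ‖D R t‖ ≤ C := by
    intro R hR t h
    obtain ⟨e1, e2⟩ := Eint0 R hR t h
    have k : 0 ≤ 1 / (4 * L) := by positivity
    have k1 := mul_nonneg k e1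
    have k2 := mul_le_mul_of_nonneg_left e2 k
    have := F0 t R
    have := F0 t (-R)
    have := Fup t h R
    have := Fup t h (-R)
    have : 0 ≤ 1 / (4 * L) * (2 * M ^ 2) := by positivity
    rw [Real.norm_eq_abs, abs_le]
    simp only [hD, hC]
    constructor <;> nlinarith
  have memIoc : ∀ t, t ∈ Set.uIoc t₁ t₂ → t₁ < t ∧ t ≤ t₂ := by
    intro t h; rw [Set.uIoc_of_le ht] at h; exact h
  have lim : Tendsto (fun R => ∫ t in t₁..t₂, D R t) atTop
      (𝓝 (∫ t in t₁..t₂, 1 / (4 * L) * ∫ x, E t x)) := by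
    refine intervalIntegral.tendsto_integral_filter_of_dominated_convergence (fun _ => C) ?_ ?_ ?_ ?_
    · filter_upwards [eventually_ge_atTop 0] with R hR using (Dmeas R hR).aestronglyMeasurable
    · filter_upwards [eventually_ge_atTop 0] with R hR
      refine Eventually.of_forall fun t h => Dbd R hR t (ht₁.trans (memIoc t h).1).le
    · exact intervalIntegrable_const
    · refine Eventually.of_forall fun t h => ?_
      have h0 : 0 ≤ t := (ht₁.trans (memIoc t h).1).le
      have l1 := (intervalIntegral_tendsto_integral (Ei t h0) tendsto_neg_atTop_atBot
        tendsto_id).const_mul (1 / (4 * L))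
      have l2 := (l1.sub (Ftop t h0)).sub ((Fbot t h0).comp tendsto_neg_atTop_atBot)
      simpa [hD] using l2
  have Dii : ∀ R, 0 ≤ R → IntervalIntegrable (D R) volume t₁ t₂ := by
    intro R hR
    refine (intervalIntegrable_const (c := C)).mono_fun (Dmeas R hR).aestronglyMeasurable ?_
    refine (ae_restrict_iff' measurableSet_uIoc).2 (Eventually.of_forall fun t h => ?_)
    exact (Dbd R hR t (ht₁.trans (memIoc t h).1).le).trans (le_abs_self C)
  have Dup : ∀ R, 0 ≤ R → ∫ t in t₁..t₂, D R t ≤ 2 * M := by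
    intro R hR
    refine le_trans (intervalIntegral.integral_mono_on ht (Dii R hR) ?_ fun t h =>
      step R hR t (ht₁.trans_le h.1)) (upper R hR)
    refine Continuous.intervalIntegrable ?_ _ _
    exact intervalIntegral.continuous_parametric_intervalIntegral_of_continuous'
      ((cφ.comp continuous_snd).mul ct) _ _
  have fin : ∫ t in t₁..t₂, 1 / (4 * L) * ∫ x, E t x ≤ 2 * M :=
    le_of_tendsto lim (by filter_upwards [eventually_ge_atTop 0] with R hR using Dup R hR)
  refine le_trans ?_ fin
  have Em : StronglyMeasurable (fun t => 1 / (4 * L) * ∫ x, E t x) :=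
    (Ec.stronglyMeasurable.integral_prod_right' (ν := volume)).const_mul _
  have Eii : IntervalIntegrable (fun t => 1 / (4 * L) * ∫ x, E t x) volume t₁ t₂ := by
    refine (intervalIntegrable_const (c := 1 / (4 * L) * (2 * M ^ 2))).mono_fun
      Em.aestronglyMeasurable ?_
    refine (ae_restrict_iff' measurableSet_uIoc).2 (Eventually.of_forall fun t h => ?_)
    have h0 : 0 ≤ t := (ht₁.trans (memIoc t h).1).le
    have h1 : 0 ≤ ∫ x, E t x := integral_nonneg (E0 t)
    have h2 := Ele t h0
    simp only [Real.norm_eq_abs]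
    rw [abs_of_nonneg (by positivity), abs_of_nonneg (by positivity)]
    gcongr
  calc (t₂ - t₁) * (a / (4 * L)) = ∫ t in t₁..t₂, a / (4 * L) := by
        rw [intervalIntegral.integral_const, smul_eq_mul]
    _ ≤ _ := by
        refine intervalIntegral.integral_mono_on ht intervalIntegrable_const Eii fun t h => ?_
        have := ha t h
        rw [div_eq_mul_one_div, mul_comm]
        gcongr

lemma lam_half (t : ℝ) : lam (1 / 2) t = (Real.log t / √t)⁻¹ := by
  unfold lam; rw [Real.sqrt_eq_rpow, inv_div]

lemma lam_facts (t : ℝ) (h : exp 2 ≤ t) : 0 < lam (1 / 2) t ∧ lam (1 / 2) t ≤ √t := by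
  have t0 : 0 < t := (exp_pos 2).trans_le h
  have l2 : 2 ≤ Real.log t := (Real.le_log_iff_exp_le t0).2 h
  have s0 := Real.sqrt_pos.2 t0
  rw [lam_half, inv_div]
  refine ⟨by positivity, div_le_self s0.le (by linarith)⟩

lemma lam_mono (s t : ℝ) (h : exp 2 ≤ s) (hst : s ≤ t) : lam (1 / 2) s ≤ lam (1 / 2) t := by
  have h1 := Real.log_div_sqrt_antitoneOn (Set.mem_Ici.2 h) (Set.mem_Ici.2 (h.trans hst)) hst
  rw [lam_half, lam_half]
  have := (lam_facts t (h.trans hst)).1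
  rw [lam_half] at this
  exact inv_anti₀ (inv_pos.1 this) h1

end Aux

/-- For a global classical `H²` solution with nonnegative momentum and
`λ(t) = t^{1/2}/log t`, `liminf_{t→∞} ∫ sech²(x/λ(t)) (u² + (∂ₓu)²) dx = 0`. -/
theorem weighted_local_energy_liminf (b : ℝ) (hb : b ∈ Set.Ioo (0 : ℝ) 3)
    (u : ℝ → ℝ → ℝ) (hu : IsH2NonnegMomentumSolution b u) :
    Filter.liminf
      (fun t : ℝ =>
        ∫ x : ℝ, sech2 (x / lam (1 / 2) t) * ((u t x) ^ 2 + (deriv (u t) x) ^ 2))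
      Filter.atTop = 0 := by
  rw [Filter.liminf_eq]
  refine IsLUB.csSup_eq (IsGreatest.isLUB ⟨?_, ?_⟩) ⟨0, ?_⟩
  · exact Eventually.of_forall fun t =>
      integral_nonneg fun x => mul_nonneg (sech2_nonneg _) (by positivity)
  · intro a ha
    by_contra hcon
    have apos : 0 < a := not_le.1 hcon
    obtain ⟨T₀, hT₀⟩ := eventually_atTop.1 ha
    have key : ∀ T, max T₀ (exp 2) ≤ T → √(2 * T) * (a / 8) ≤ 2 * ∫ x, mom u 0 x := by
      intro T hT
      have h1 : T₀ ≤ T := (le_max_left _ _).trans hT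
      have h2 : exp 2 ≤ T := (le_max_right _ _).trans hT
      have Tpos : 0 < T := (exp_pos 2).trans_le h2
      obtain ⟨l0, l1⟩ := lam_facts (2 * T) (by linarith)
      have hm := main_ineq b hb u hu T (2 * T) (lam (1 / 2) (2 * T)) a Tpos (by linarith) l0 ?_
      · refine le_trans ?_ hm
        have s0 : 0 < √(2 * T) := Real.sqrt_pos.2 (by linarith)
        have e : √(2 * T) * (a / 8) = (2 * T - T) * (a / (4 * √(2 * T))) := by
          have := Real.mul_self_sqrt (by linarith : 0 ≤ 2 * T)
          field_simp
          nlinarith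
        rw [e]
        have : 0 ≤ 2 * T - T := by linarith
        gcongr
      · intro t ht
        refine (hT₀ t (h1.trans ht.1)).trans ?_
        have t2 : exp 2 ≤ t := h2.trans ht.1
        have t0 : 0 ≤ t := (exp_pos 2).le.trans t2
        obtain ⟨-, -, -, -, -, -, -, -, -, hint, -⟩ := id hu
        have hux := hu.2.1 t
        have base := (hint t t0).2.1.add (hint t t0).2.2.2.1
        have I : ∀ l : ℝ, Integrable
            (fun x => sech2 (x / l) * ((u t x) ^ 2 + (deriv (u t) x) ^ 2)) := by
          intro l
          refine base.bdd_mul (c := 1)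
            (sech2_continuous.comp (continuous_id.div_const l)).aestronglyMeasurable ?_
          refine Eventually.of_forall fun x => ?_
          rw [Real.norm_eq_abs, abs_of_nonneg (sech2_nonneg _)]; exact sech2_le_one _
        refine integral_mono (I _) (I _) fun x => ?_
        exact mul_le_mul_of_nonneg_right
          (sech2_mono x _ _ (lam_facts t t2).1 (lam_mono t (2 * T) t2 ht.2)) (by positivity)
    have lim : Tendsto (fun T : ℝ => √(2 * T) * (a / 8)) atTop atTop :=
      (Real.tendsto_sqrt_atTop.comp
        (tendsto_id.const_mul_atTop (by norm_num : (0 : ℝ) < 2))).atTop_mul_const (by positivity)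
    obtain ⟨T, hTa, hTb⟩ := ((lim.eventually_gt_atTop (2 * ∫ x, mom u 0 x)).and
      (eventually_ge_atTop (max T₀ (exp 2)))).exists
    linarith [key T hTb]
  · exact Eventually.of_forall fun t =>
      integral_nonneg fun x => mul_nonneg (sech2_nonneg _) (by positivity)
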